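/- Let x = (x_k)_{k≥1} be a sequence of pairwise distinct points of the unit circle 𝕋 = ℝ/ℤ. For all n ≥ 1 and 1 ≤ k ≤ n, the k-th largest gap length t_{n,k} of the set x[n] = {x_1, …, x_n} satisfies t_{n,k} ≤ 2 · D_{n+k−1}(x). -/

import Mathlib

/-- The length of the gap (open arc) of the finite set `S ⊂ 𝕋 = ℝ/ℤ` that starts at the
point `s`: the least `ℓ > 0` such that moving counterclockwise from `s` by `ℓ` lands in `S`.
For `s ∈ S` this is the length of the gap of `S` whose initial endpoint is `s`. -/
noncomputable def gapAt (S : Finset (AddCircle (1 : ℝ))) (s : AddCircle (1 : ℝ)) : ℝ :=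
  sInf {ℓ : ℝ | 0 < ℓ ∧ s + ((ℓ : ℝ) : AddCircle (1 : ℝ)) ∈ S}

/-- The gap lengths of a finite set `S ⊂ 𝕋`, listed in non-increasing order
(each gap is recorded at its initial endpoint, so there are `S.card` of them,
with multiplicity). -/
noncomputable def sortedGaps (S : Finset (AddCircle (1 : ℝ))) : List ℝ :=
  (S.val.map (gapAt S)).sort (· ≥ ·)

/-- `gapLen S k` is `t_k(S)`, the `k`-th largest gap length of `S` (1-indexed). -/
noncomputable def gapLen (S : Finset (AddCircle (1 : ℝ))) (k : ℕ) : ℝ :=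
  (sortedGaps S).getD (k - 1) 0

/-- The covering radius `D_m(x)` of the first `m` terms of a sequence `x` in the
unit circle `𝕋 = ℝ/ℤ`. -/
noncomputable def covRad (x : ℕ → AddCircle (1 : ℝ)) (m : ℕ) : ℝ :=
  ⨆ t : AddCircle (1 : ℝ), sInf ((fun k => dist t (x k)) '' Set.Icc 1 m)

theorem aux_notMem {S : Finset (AddCircle (1 : ℝ))} {s : AddCircle (1 : ℝ)} {v : ℝ}
    (h0 : 0 < v) (hv : v < gapAt S s) : s + (v : AddCircle (1 : ℝ)) ∉ S := by
  intro h
  have hb : BddBelow {ℓ : ℝ | 0 < ℓ ∧ s + ((ℓ : ℝ) : AddCircle (1 : ℝ)) ∈ S} :=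
    ⟨0, fun y hy => hy.1.le⟩
  exact absurd (csInf_le hb (show v ∈ {ℓ : ℝ | 0 < ℓ ∧ s + ((ℓ : ℝ) : AddCircle (1 : ℝ)) ∈ S}
    from ⟨h0, h⟩)) (not_le.mpr hv)

theorem aux_lift (a : AddCircle (1 : ℝ)) : ∃ u : ℝ, (u : AddCircle (1 : ℝ)) = a ∧ |u| = ‖a‖ := by
  induction a using QuotientAddGroup.induction_on with
  | H z =>
    refine ⟨z - round z, ?_, ?_⟩
    · have h : ((round z : ℝ) : AddCircle (1 : ℝ)) = 0 := by
        rw [AddCircle.coe_eq_zero_iff]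
        exact ⟨round z, by simp⟩
      rw [AddCircle.coe_sub, h, sub_zero]
    · have := AddCircle.norm_eq (p := (1 : ℝ)) (x := z)
      simp at this
      exact this.symm

theorem aux_cov (x : ℕ → AddCircle (1 : ℝ)) (m : ℕ) (hm : 1 ≤ m) (t : AddCircle (1 : ℝ)) :
    ∃ j ∈ Set.Icc 1 m, dist t (x j) ≤ covRad x m := by
  have hne : ∀ t, ((fun k => dist t (x k)) '' Set.Icc 1 m).Nonempty :=
    fun t => ⟨_, 1, ⟨le_rfl, hm⟩, rfl⟩
  have hfin : ∀ t, ((fun k => dist t (x k)) '' Set.Icc 1 m).Finite :=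
    fun t => (Set.finite_Icc 1 m).image _
  obtain ⟨j, hj, hj2⟩ := (hne t).csInf_mem (hfin t)
  refine ⟨j, hj, ?_⟩
  have hb : BddAbove (Set.range fun t : AddCircle (1 : ℝ) =>
      sInf ((fun k => dist t (x k)) '' Set.Icc 1 m)) := by
    refine ⟨1 / 2, ?_⟩
    rintro _ ⟨t, rfl⟩
    refine (csInf_le (hfin t).bddBelow ⟨1, ⟨le_rfl, hm⟩, rfl⟩).trans ?_
    have := AddCircle.norm_le_half_period (1 : ℝ) (x := t - x 1) one_ne_zero
    simpa [dist_eq_norm] using this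
  have := le_ciSup hb t
  simp only at hj2
  rw [hj2]
  exact this

theorem aux_count (S : Finset (AddCircle (1 : ℝ))) (k : ℕ) (hk : 1 ≤ k) (hS : k ≤ S.card) :
    k ≤ (S.filter (fun s => gapLen S k ≤ gapAt S s)).card := by
  classical
  have hlen : (sortedGaps S).length = S.card := by simp [sortedGaps]
  have hsort : (sortedGaps S).Pairwise (· ≥ ·) := Multiset.pairwise_sort _ _
  have hlt : k - 1 < (sortedGaps S).length := by omega
  have hg : gapLen S k = (sortedGaps S)[k - 1] := by
    simp [gapLen, List.getD_eq_getElem?_getD, hlt]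
  have h1 : k ≤ (sortedGaps S).countP (fun y => decide (gapLen S k ≤ y)) := by
    have hsub := (List.take_sublist k (sortedGaps S)).countP_le
      (p := fun y => decide (gapLen S k ≤ y))
    have hall : ((sortedGaps S).take k).countP (fun y => decide (gapLen S k ≤ y))
        = ((sortedGaps S).take k).length := by
      rw [List.countP_eq_length]
      intro a ha
      obtain ⟨i, hi, rfl⟩ := List.getElem_of_mem ha
      have hi' : i < k := by
        have := hi
        simp at this
        omega
      simp only [List.getElem_take, decide_eq_true_eq]
      rw [hg]
      rcases Nat.lt_or_ge i (k - 1) with h | h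
      · exact List.pairwise_iff_getElem.mp hsort i (k - 1) (by omega) hlt h
      · have : i = k - 1 := by omega
        subst this
        exact le_rfl
    rw [hall, List.length_take] at hsub
    omega
  have h2 : (sortedGaps S).countP (fun y => decide (gapLen S k ≤ y))
      = (S.filter (fun s => gapLen S k ≤ gapAt S s)).card := by
    rw [← Multiset.coe_countP, sortedGaps, Multiset.sort_eq, Multiset.countP_map]
    rfl
  omega

/-- For a sequence `x` of pairwise distinct points of the unit circle, the `k`-th
largest gap length `t_{n,k}` of `x[n] = {x_1, …, x_n}` satisfies
`t_{n,k} ≤ 2·D_{n+k−1}(x)` for all `n ≥ 1` and `1 ≤ k ≤ n`. -/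
theorem gapLen_le_two_mul_covRad (x : ℕ → AddCircle (1 : ℝ))
    (hx : ∀ i j : ℕ, 1 ≤ i → 1 ≤ j → i ≠ j → x i ≠ x j) :
    ∀ n k : ℕ, 1 ≤ k → k ≤ n →
      gapLen ((Finset.Icc 1 n).image x) k ≤ 2 * covRad x (n + k - 1) := by
  classical
  intro n k hk hkn
  by_contra! hlt
  set S := (Finset.Icc 1 n).image x with hSdef
  have hcard : S.card = n := by
    rw [hSdef, Finset.card_image_of_injOn, Nat.card_Icc]
    · omega
    · intro i hi j hj hij
      by_contra hne
      simp at hi hj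
      exact hx i j hi.1 hj.1 hne hij
  have hcount := aux_count S k hk (by omega)
  set F := S.filter (fun s => gapLen S k ≤ gapAt S s) with hF
  have key : ∀ s ∈ F, ∃ j ∈ Finset.Icc (n + 1) (n + k - 1), ∃ v : ℝ, 0 < v ∧ v < gapAt S s ∧
      s + (v : AddCircle (1 : ℝ)) = x j := by
    intro s hs
    have hs2 : gapLen S k ≤ gapAt S s := (Finset.mem_filter.mp hs).2
    obtain ⟨j, hj, hd⟩ := aux_cov x (n + k - 1) (by omega)
      (s + ((gapAt S s / 2 : ℝ) : AddCircle (1 : ℝ)))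
    obtain ⟨u, hu, hu2⟩ := aux_lift (s + ((gapAt S s / 2 : ℝ) : AddCircle (1 : ℝ)) - x j)
    rw [← dist_eq_norm] at hu2
    have hu3 : |u| < gapAt S s / 2 := by linarith
    obtain ⟨ha, hb⟩ := abs_lt.mp hu3
    have hv0 : 0 < gapAt S s / 2 - u := by linarith
    have hv1 : gapAt S s / 2 - u < gapAt S s := by linarith
    have he : s + ((gapAt S s / 2 - u : ℝ) : AddCircle (1 : ℝ)) = x j := by
      rw [AddCircle.coe_sub, hu]
      abel
    refine ⟨j, ?_, _, hv0, hv1, he⟩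
    have hnot := aux_notMem hv0 hv1
    rw [he] at hnot
    have : ¬ j ≤ n := fun h => hnot (Finset.mem_image.mpr ⟨j, Finset.mem_Icc.mpr ⟨hj.1, h⟩, rfl⟩)
    exact Finset.mem_Icc.mpr ⟨by omega, hj.2⟩
  choose! f hf v hv0 hv1 he using key
  obtain ⟨s, hs, s', hs', hne, hff⟩ := Finset.exists_ne_map_eq_of_card_lt_of_maps_to
    (s := F) (t := Finset.Icc (n + 1) (n + k - 1)) (f := f)
    (by rw [Nat.card_Icc]; omega) hf
  have main : ∀ a ∈ F, ∀ b ∈ F, f a = f b → v a < v b → False := by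
    intro a ha b hb hab hlt
    have h1 : b + ((v b - v a : ℝ) : AddCircle (1 : ℝ)) = a := by
      have h2 := (he b hb).trans ((congrArg x hab.symm).trans (he a ha).symm)
      rw [AddCircle.coe_sub, ← add_sub_assoc, h2]
      abel
    have h3 := aux_notMem (S := S) (s := b) (v := v b - v a) (by linarith)
      (by linarith [hv0 a ha, hv1 b hb])
    rw [h1] at h3
    exact h3 (Finset.mem_filter.mp ha).1
  rcases lt_trichotomy (v s) (v s') with h | h | h
  · exact main s hs s' hs' hff h
  · apply hne
    have h2 := (he s hs).trans ((congrArg x hff).trans (he s' hs').symm)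
    rw [h] at h2
    exact add_right_cancel h2
  · exact main s' hs' s hs hff.symm h
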